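/- RDE vector-field iteration reads right-to-left: for a smooth field of linear maps F ∈ C^∞(W, L(V,W)) and a smooth function g, the iterated directional derivative F_{γ_1}···F_{γ_n} g(y), defined left-to-right via F_γ h(y) = ∂_k h(y) F^k_γ(y), equals F_{γ_1}···F_{γ_{n-1}}(F_{γ_n} g)(y) for all n ≥ 2; moreover the composite satisfies the ordered-shuffle expansion F_γ g^c(y) = Σ over decompositions of γ into ordered shuffles of nonempty words γ^1,...,γ^m of ∂_{k_1...k_m}g^c(y) · F_{γ^1}1^{k_1}(y) ··· F_{γ^m}1^{k_m}(y), where 1 denotes the identity function. -/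

import Mathlib

/-- Multiset of all shuffles (interleavings) of two lists. -/
def shuffles {α : Type*} : List α → List α → Multiset (List α)
  | [], bs => {bs}
  | a :: as, [] => {a :: as}
  | a :: as, b :: bs =>
      (shuffles as (b :: bs)).map (a :: ·) + (shuffles (a :: as) bs).map (b :: ·)
termination_by as bs => as.length + bs.length

/-- Half (ordered) shuffle of two words: the shuffles in which the last letter
of the second word stays last.  Convention: `osh2 a [] = 0`, `osh2 [] b = {b}`. -/
def osh2 {α : Type*} (a b : List α) : Multiset (List α) :=
  match b.getLast? with
  | none => 0
  | some x => (shuffles a b.dropLast).map (· ++ [x])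

/-- Multiset of ordered shuffles of a list of words (iterated half-shuffle,
left to right): interleavings in which the final letters of the words appear
in the given relative order. -/
def oshMany {α : Type*} (ws : List (List α)) : Multiset (List α) :=
  ws.foldl (fun acc w => acc.bind fun u => osh2 u w) {([] : List α)}

/-- Multiset of all shuffles of a list of words. -/
def shMany {α : Type*} (ws : List (List α)) : Multiset (List α) :=
  ws.foldl (fun acc w => acc.bind fun u => shuffles u w) {([] : List α)}

/-- Bounded words: words over `Fin d` of length at most `N`. -/
abbrev BWord (d N : ℕ) := Σ l : Fin (N + 1), Fin (l : ℕ) → Fin d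

/-- The word (list) underlying a bounded word. -/
def bwList {d N : ℕ} (g : BWord d N) : List (Fin d) := List.ofFn g.2

/-- The action of the vector field `F_γ = Σ_k F^k_γ ∂_k` on a scalar
function `h`: `(F_γ h)(y) = ∂_k h(y) F^k_γ(y)`. -/
noncomputable def vf {dW dV : ℕ} (F : (Fin dW → ℝ) → Fin dV → Fin dW → ℝ)
    (γ : Fin dV) (h : (Fin dW → ℝ) → ℝ) : (Fin dW → ℝ) → ℝ :=
  fun y => ∑ k, fderiv ℝ h y (Pi.single k 1) * F y γ k

/-- Iterated directional derivative `F_{γ₁}⋯F_{γ_n} g`, defined left to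
right: `F_γ g = F_{γ₁}(F_{γ₂}(⋯ F_{γ_n} g))`. -/
noncomputable def vfWord {dW dV : ℕ} (F : (Fin dW → ℝ) → Fin dV → Fin dW → ℝ) :
    List (Fin dV) → ((Fin dW → ℝ) → ℝ) → (Fin dW → ℝ) → ℝ
  | [], g => g
  | γ :: rest, g => vf F γ (vfWord F rest g)

/-- Sum of `f u v` over all ways to split the word into complementary subwords `u` and `v`. -/
def unshuffleSum {α : Type*} : List α → (List α → List α → ℝ) → ℝ
  | [], f => f [] []
  | a :: γ, f =>
      unshuffleSum γ (fun u v => f (a :: u) v) + unshuffleSum γ (fun u v => f u (a :: v))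

section UnshuffleSum

variable {α : Type*}

theorem unshuffleSum_congr (γ : List α) {f g : List α → List α → ℝ}
    (h : ∀ u v, u.length ≤ γ.length → v.length ≤ γ.length → f u v = g u v) :
    unshuffleSum γ f = unshuffleSum γ g := by
  induction γ generalizing f g with
  | nil => exact h [] [] le_rfl le_rfl
  | cons a γ ih =>
    simp only [unshuffleSum]
    congr 1
    · exact ih fun u v hu hv => h _ _ (by simpa using hu) (by simp; omega)
    · exact ih fun u v hu hv => h _ _ (by simp; omega) (by simpa using hv)

theorem unshuffleSum_zero (γ : List α) : unshuffleSum γ (fun _ _ => 0) = 0 := by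
  induction γ with
  | nil => rfl
  | cons a γ ih => simp [unshuffleSum, ih]

theorem unshuffleSum_add (γ : List α) (f g : List α → List α → ℝ) :
    unshuffleSum γ (fun u v => f u v + g u v) = unshuffleSum γ f + unshuffleSum γ g := by
  induction γ generalizing f g with
  | nil => rfl
  | cons a γ ih => simp only [unshuffleSum, ih]; ring

theorem unshuffleSum_mul_right (γ : List α) (f : List α → List α → ℝ) (c : ℝ) :
    unshuffleSum γ (fun u v => f u v * c) = unshuffleSum γ f * c := by
  induction γ generalizing f with
  | nil => rfl
  | cons a γ ih => simp only [unshuffleSum, ih]; ring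

theorem unshuffleSum_sum {ι : Type*} (s : Finset ι) (γ : List α)
    (f : ι → List α → List α → ℝ) :
    unshuffleSum γ (fun u v => ∑ i ∈ s, f i u v) = ∑ i ∈ s, unshuffleSum γ (f i) := by
  induction γ generalizing f with
  | nil => rfl
  | cons a γ ih => simp only [unshuffleSum, ih, Finset.sum_add_distrib]

theorem count_shuffles [DecidableEq α] (γ u v : List α) :
    ((shuffles u v).count γ : ℝ) =
      unshuffleSum γ (fun u' v' => if v = v' then (if u = u' then 1 else 0) else 0) := by
  have key (a b : α) (γ : List α) (S : Multiset (List α)) :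
      (S.map (b :: ·)).count (a :: γ) = if a = b then S.count γ else 0 := by
    split_ifs with h
    · subst h
      exact Multiset.count_map_eq_count' _ _ List.cons_injective _
    · exact Multiset.count_eq_zero.2 (by simp; tauto)
  induction γ generalizing u v with
  | nil =>
    cases u <;> cases v <;> simp [shuffles, unshuffleSum]
  | cons a γ ih =>
    rcases u with _ | ⟨b, u⟩
    · have := ih [] v.tail
      rcases v with _ | ⟨c, v⟩
      · simp [shuffles, unshuffleSum, unshuffleSum_zero]
      · by_cases h : c = a <;>
          simp_all [shuffles, unshuffleSum, unshuffleSum_zero, Multiset.count_singleton, eq_comm]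
    · rcases v with _ | ⟨c, v⟩
      · have h0 : shuffles u ([] : List α) = {u} := by cases u <;> simp [shuffles]
        have := ih u []
        by_cases h : b = a <;>
          simp_all [shuffles, unshuffleSum, unshuffleSum_zero, Multiset.count_singleton, eq_comm]
      · have h1 := ih u (c :: v)
        have h2 := ih (b :: u) v
        rw [shuffles, Multiset.count_add, key, key]
        by_cases hb : b = a <;> by_cases hc : c = a <;>
          simp_all [unshuffleSum, unshuffleSum_zero, eq_comm]

theorem osh2_concat (u v : List α) (x : α) :
    osh2 u (v ++ [x]) = (shuffles u v).map (· ++ [x]) := by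
  simp [osh2]

theorem count_osh2 [DecidableEq α] (γ u w : List α) (b : α) :
    ((osh2 u w).count (γ ++ [b]) : ℝ) =
      unshuffleSum γ (fun u' v' => if w = v' ++ [b] then (if u = u' then 1 else 0) else 0) := by
  rcases List.eq_nil_or_concat' w with rfl | ⟨v, x, rfl⟩
  · simp [osh2, unshuffleSum_zero]
  · rw [osh2_concat]
    by_cases h : x = b
    · subst h
      rw [Multiset.count_map_eq_count' _ _ (List.append_left_injective [x]), count_shuffles]
      simp
    · rw [Multiset.count_eq_zero.2 (by simp; tauto)]
      simp [h, unshuffleSum_zero]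

theorem count_bind_osh2 [DecidableEq α] (A : Multiset (List α)) (γ w : List α) (b : α) :
    ((A.bind fun u => osh2 u w).count (γ ++ [b]) : ℝ) =
      unshuffleSum γ (fun u v => if w = v ++ [b] then (A.count u : ℝ) else 0) := by
  induction A using Multiset.induction_on with
  | empty => simp [unshuffleSum_zero]
  | cons x A ih =>
    rw [Multiset.cons_bind, Multiset.count_add, Nat.cast_add, ih, count_osh2, ← unshuffleSum_add]
    refine unshuffleSum_congr _ fun u v _ _ => ?_
    simp only [eq_comm (a := x), Multiset.count_cons]
    split_ifs <;> simp [add_comm]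

theorem oshMany_concat (ws : List (List α)) (w : List α) :
    oshMany (ws ++ [w]) = (oshMany ws).bind fun u => osh2 u w := by
  simp [oshMany]

theorem nil_notMem_oshMany_concat (ws : List (List α)) (w : List α) :
    [] ∉ oshMany (ws ++ [w]) := by
  rw [oshMany_concat]
  rcases List.eq_nil_or_concat' w with rfl | ⟨v, x, rfl⟩
  · simp [osh2]
  · simp [osh2_concat]

end UnshuffleSum

theorem sum_bwList_eq {d N : ℕ} (f : List (Fin d) → ℝ) (x : List (Fin d)) (hx : x.length ≤ N) :
    ∑ w : BWord d N, (if bwList w = x then f (bwList w) else 0) = f x := by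
  have h0 : bwList (⟨⟨x.length, by omega⟩, x.get⟩ : BWord d N) = x := List.ofFn_get x
  rw [Finset.sum_eq_single (⟨⟨x.length, by omega⟩, x.get⟩ : BWord d N)]
  · rw [h0, if_pos rfl]
  · rintro ⟨⟨l, hl⟩, w⟩ _ hne
    refine if_neg fun h => hne ?_
    subst h
    have hlen : l = (List.ofFn w).length := (List.length_ofFn).symm
    simp only [bwList]
    refine Sigma.ext (Fin.ext (by simp)) ?_
    exact (Fin.heq_fun_iff hlen).2 fun i => by simp
  · simp

section VectorField

variable {dW dV : ℕ} {F : (Fin dW → ℝ) → Fin dV → Fin dW → ℝ}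

theorem vfWord_append (l l' : List (Fin dV)) (g : (Fin dW → ℝ) → ℝ) :
    vfWord F (l ++ l') g = vfWord F l (vfWord F l' g) := by
  induction l with
  | nil => rfl
  | cons a l ih => simp [vfWord, ih]

theorem contDiff_fderiv_apply {g : (Fin dW → ℝ) → ℝ} (hg : ContDiff ℝ (⊤ : ℕ∞) g)
    (e : Fin dW → ℝ) : ContDiff ℝ (⊤ : ℕ∞) (fun y => fderiv ℝ g y e) :=
  (hg.fderiv_right (by simp)).clm_apply contDiff_const

theorem contDiff_vf (hF : ContDiff ℝ (⊤ : ℕ∞) F) (γ : Fin dV) {g : (Fin dW → ℝ) → ℝ}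
    (hg : ContDiff ℝ (⊤ : ℕ∞) g) : ContDiff ℝ (⊤ : ℕ∞) (vf F γ g) :=
  ContDiff.sum fun k _ => (contDiff_fderiv_apply hg _).mul
    (contDiff_pi.1 (contDiff_pi.1 hF γ) k)

theorem contDiff_vfWord (hF : ContDiff ℝ (⊤ : ℕ∞) F) (γ : List (Fin dV))
    {g : (Fin dW → ℝ) → ℝ} (hg : ContDiff ℝ (⊤ : ℕ∞) g) :
    ContDiff ℝ (⊤ : ℕ∞) (vfWord F γ g) := by
  induction γ with
  | nil => exact hg
  | cons a γ ih => exact contDiff_vf hF a ih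

theorem vf_add (γ : Fin dV) {f g : (Fin dW → ℝ) → ℝ} (hf : ContDiff ℝ (⊤ : ℕ∞) f)
    (hg : ContDiff ℝ (⊤ : ℕ∞) g) :
    vf F γ (fun y => f y + g y) = fun y => vf F γ f y + vf F γ g y := by
  funext y
  have hf' := (hf.differentiable (by simp)) y
  have hg' := (hg.differentiable (by simp)) y
  simp only [vf]
  rw [fderiv_fun_add hf' hg']
  simp [add_mul, Finset.sum_add_distrib]

theorem vf_mul (γ : Fin dV) {f g : (Fin dW → ℝ) → ℝ} (hf : ContDiff ℝ (⊤ : ℕ∞) f)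
    (hg : ContDiff ℝ (⊤ : ℕ∞) g) :
    vf F γ (fun y => f y * g y) = fun y => vf F γ f y * g y + f y * vf F γ g y := by
  funext y
  have hf' := (hf.differentiable (by simp)) y
  have hg' := (hg.differentiable (by simp)) y
  simp only [vf]
  rw [fderiv_fun_mul hf' hg', Finset.sum_mul, Finset.mul_sum, ← Finset.sum_add_distrib]
  refine Finset.sum_congr rfl fun k _ => ?_
  simp
  ring

theorem vf_sum (γ : Fin dV) {ι : Type*} (s : Finset ι) {f : ι → (Fin dW → ℝ) → ℝ}
    (hf : ∀ i, ContDiff ℝ (⊤ : ℕ∞) (f i)) :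
    vf F γ (fun y => ∑ i ∈ s, f i y) = fun y => ∑ i ∈ s, vf F γ (f i) y := by
  funext y
  simp only [vf]
  rw [fderiv_fun_sum fun i _ => ((hf i).differentiable (by simp)) y, Finset.sum_comm]
  simp [Finset.sum_mul]

theorem vfWord_sum (hF : ContDiff ℝ (⊤ : ℕ∞) F) (γ : List (Fin dV)) {ι : Type*} (s : Finset ι)
    {f : ι → (Fin dW → ℝ) → ℝ} (hf : ∀ i, ContDiff ℝ (⊤ : ℕ∞) (f i)) :
    vfWord F γ (fun y => ∑ i ∈ s, f i y) = fun y => ∑ i ∈ s, vfWord F γ (f i) y := by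
  induction γ with
  | nil => rfl
  | cons a γ ih =>
    simp only [vfWord]
    rw [ih, vf_sum a s fun i => contDiff_vfWord hF γ (hf i)]

theorem contDiff_unshuffleSum {α : Type*} (γ : List α)
    {G : List α → List α → (Fin dW → ℝ) → ℝ} (hG : ∀ u v, ContDiff ℝ (⊤ : ℕ∞) (G u v)) :
    ContDiff ℝ (⊤ : ℕ∞) (fun y => unshuffleSum γ fun u v => G u v y) := by
  induction γ generalizing G with
  | nil => exact hG [] []
  | cons a γ ih => exact (ih fun u v => hG _ _).add (ih fun u v => hG _ _)

theorem vf_unshuffleSum {α : Type*} (b : Fin dV) (γ : List α)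
    {G : List α → List α → (Fin dW → ℝ) → ℝ} (hG : ∀ u v, ContDiff ℝ (⊤ : ℕ∞) (G u v)) :
    vf F b (fun y => unshuffleSum γ fun u v => G u v y) =
      fun y => unshuffleSum γ fun u v => vf F b (G u v) y := by
  induction γ generalizing G with
  | nil => rfl
  | cons a γ ih =>
    simp only [unshuffleSum]
    rw [vf_add b (contDiff_unshuffleSum γ fun u v => hG _ _)
      (contDiff_unshuffleSum γ fun u v => hG _ _), ih fun u v => hG _ _, ih fun u v => hG _ _]

/-- The Leibniz rule for iterated vector fields. -/
theorem vfWord_mul (hF : ContDiff ℝ (⊤ : ℕ∞) F) (γ : List (Fin dV)) {f g : (Fin dW → ℝ) → ℝ}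
    (hf : ContDiff ℝ (⊤ : ℕ∞) f) (hg : ContDiff ℝ (⊤ : ℕ∞) g) :
    vfWord F γ (fun y => f y * g y) =
      fun y => unshuffleSum γ fun u v => vfWord F u f y * vfWord F v g y := by
  induction γ with
  | nil => rfl
  | cons a γ ih =>
    rw [vfWord, ih, vf_unshuffleSum a γ
      fun u v => (contDiff_vfWord hF u hf).mul (contDiff_vfWord hF v hg)]
    funext y
    rw [unshuffleSum, ← unshuffleSum_add]
    refine unshuffleSum_congr γ fun u v _ _ => ?_
    rw [vf_mul a (contDiff_vfWord hF u hf) (contDiff_vfWord hF v hg)]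
    rfl

theorem vf_coord (b : Fin dV) (k : Fin dW) : vf F b (fun z => z k) = fun y => F y b k := by
  funext y
  have h (j : Fin dW) : fderiv ℝ (fun z : Fin dW → ℝ => z k) y (Pi.single j 1) =
      (Pi.single j (1 : ℝ) : Fin dW → ℝ) k := by
    rw [show (fun z : Fin dW → ℝ => z k) =
      (ContinuousLinearMap.proj k : (Fin dW → ℝ) →L[ℝ] ℝ) from rfl, ContinuousLinearMap.fderiv]
    rfl
  simp [vf, h, Pi.single_apply]

theorem vfWord_concat (hF : ContDiff ℝ (⊤ : ℕ∞) F) (γ : List (Fin dV)) (b : Fin dV)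
    {g : (Fin dW → ℝ) → ℝ} (hg : ContDiff ℝ (⊤ : ℕ∞) g) (y : Fin dW → ℝ) :
    vfWord F (γ ++ [b]) g y = unshuffleSum γ fun u v => ∑ k,
      vfWord F u (fun z => fderiv ℝ g z (Pi.single k 1)) y *
        vfWord F (v ++ [b]) (fun z => z k) y := by
  have hFk (k : Fin dW) : ContDiff ℝ (⊤ : ℕ∞) fun y => F y b k :=
    contDiff_pi.1 (contDiff_pi.1 hF b) k
  rw [vfWord_append, unshuffleSum_sum]
  change vfWord F γ (fun z => ∑ k, fderiv ℝ g z (Pi.single k 1) * F z b k) y = _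
  rw [vfWord_sum hF γ _ fun k => (contDiff_fderiv_apply hg _).mul (hFk k)]
  refine Finset.sum_congr rfl fun k _ => ?_
  rw [vfWord_mul hF γ (contDiff_fderiv_apply hg _) (hFk k)]
  simp only [vfWord_append]
  simp only [vfWord, vf_coord]

theorem iteratedFDeriv_succ_snoc {m : ℕ} {g : (Fin dW → ℝ) → ℝ} (hg : ContDiff ℝ (⊤ : ℕ∞) g)
    (y : Fin dW → ℝ) (v : Fin m → Fin dW → ℝ) (e : Fin dW → ℝ) :
    iteratedFDeriv ℝ (m + 1) g y (Fin.snoc v e) =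
      iteratedFDeriv ℝ m (fun z => fderiv ℝ g z e) y v := by
  have h : ContDiff ℝ m (fderiv ℝ g) := hg.fderiv_right (by exact_mod_cast le_top)
  rw [iteratedFDeriv_succ_apply_right, Fin.init_snoc, Fin.snoc_last,
    iteratedFDeriv_clm_apply_const_apply h le_rfl]

/-- The part of the ordered-shuffle expansion with `m` words of length at most `N`. -/
noncomputable def oshTerm (F : (Fin dW → ℝ) → Fin dV → Fin dW → ℝ) (N m : ℕ)
    (γ : List (Fin dV)) (g : (Fin dW → ℝ) → ℝ) (y : Fin dW → ℝ) : ℝ :=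
  ∑ parts : Fin m → BWord dV N,
    ((oshMany (List.ofFn fun i => bwList (parts i))).count γ : ℝ) *
      ∑ k : Fin m → Fin dW,
        iteratedFDeriv ℝ m g y (fun i => Pi.single (k i) 1) *
          ∏ i, vfWord F (bwList (parts i)) (fun z => z (k i)) y

theorem oshTerm_zero_nil (N : ℕ) (g : (Fin dW → ℝ) → ℝ) (y : Fin dW → ℝ) :
    oshTerm F N 0 [] g y = g y := by
  simp [oshTerm, oshMany]

theorem oshTerm_zero_of_ne_nil (N : ℕ) {γ : List (Fin dV)} (hγ : γ ≠ [])
    (g : (Fin dW → ℝ) → ℝ) (y : Fin dW → ℝ) : oshTerm F N 0 γ g y = 0 := by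
  simp [oshTerm, oshMany, hγ]

theorem oshTerm_succ_nil (N m : ℕ) (g : (Fin dW → ℝ) → ℝ) (y : Fin dW → ℝ) :
    oshTerm F N (m + 1) [] g y = 0 := by
  refine Finset.sum_eq_zero fun parts _ => ?_
  rw [List.ofFn_succ', List.concat_eq_append,
    Multiset.count_eq_zero.2 (nil_notMem_oshMany_concat _ _)]
  simp

theorem oshTerm_succ_concat (N m : ℕ) {γ : List (Fin dV)} (hγ : γ.length < N) (b : Fin dV)
    {g : (Fin dW → ℝ) → ℝ} (hg : ContDiff ℝ (⊤ : ℕ∞) g) (y : Fin dW → ℝ) :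
    oshTerm F N (m + 1) (γ ++ [b]) g y = unshuffleSum γ fun u v => ∑ k,
      oshTerm F N m u (fun z => fderiv ℝ g z (Pi.single k 1)) y *
        vfWord F (v ++ [b]) (fun z => z k) y := by
  have hsnoc (k : Fin m → Fin dW) (j : Fin dW) :
      (fun i => Pi.single ((Fin.snoc k j : Fin (m + 1) → Fin dW) i) 1 :
        Fin (m + 1) → Fin dW → ℝ) = Fin.snoc (fun i => Pi.single (k i) 1) (Pi.single j 1) := by
    funext i
    refine Fin.lastCases ?_ (fun i => ?_) i <;> simp
  have hk (p : Fin m → BWord dV N) (w : BWord dV N) :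
      ∑ k : Fin (m + 1) → Fin dW, iteratedFDeriv ℝ (m + 1) g y (fun i => Pi.single (k i) 1) *
          ∏ i, vfWord F (bwList ((Fin.snoc p w : Fin (m + 1) → BWord dV N) i))
            (fun z => z (k i)) y =
        ∑ j, (∑ k : Fin m → Fin dW,
          iteratedFDeriv ℝ m (fun z => fderiv ℝ g z (Pi.single j 1)) y
            (fun i => Pi.single (k i) 1) *
          ∏ i, vfWord F (bwList (p i)) (fun z => z (k i)) y) *
            vfWord F (bwList w) (fun z => z j) y := by
    rw [← (Fin.snocEquiv fun _ : Fin (m + 1) => Fin dW).sum_comp, Fintype.sum_prod_type]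
    refine Finset.sum_congr rfl fun j _ => ?_
    rw [Finset.sum_mul]
    refine Finset.sum_congr rfl fun k _ => ?_
    simp only [Fin.snocEquiv_apply, hsnoc, iteratedFDeriv_succ_snoc hg, Fin.prod_univ_castSucc,
      Fin.snoc_castSucc, Fin.snoc_last, mul_assoc]
  rw [oshTerm, ← (Fin.snocEquiv fun _ : Fin (m + 1) => BWord dV N).sum_comp,
    Fintype.sum_prod_type_right]
  simp only [Fin.snocEquiv_apply, hk, List.ofFn_succ', List.concat_eq_append, Fin.snoc_castSucc,
    Fin.snoc_last, oshMany_concat, count_bind_osh2, ← unshuffleSum_mul_right, ← unshuffleSum_sum]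
  refine unshuffleSum_congr γ fun u v _ hv => ?_
  simp only [ite_mul, zero_mul, oshTerm]
  have hsum (c : ℝ) (D : Fin dW → ℝ) :
      ∑ w : BWord dV N, (if bwList w = v ++ [b] then
        c * ∑ j, D j * vfWord F (bwList w) (fun z => z j) y else 0) =
      c * ∑ j, D j * vfWord F (v ++ [b]) (fun z => z j) y :=
    sum_bwList_eq (fun w => c * ∑ j, D j * vfWord F w (fun z => z j) y) (v ++ [b])
      (by simp; omega)
  rw [Finset.sum_congr rfl fun p _ => hsum _ _]
  simp only [Finset.mul_sum, Finset.sum_mul]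
  rw [Finset.sum_comm]
  refine Finset.sum_congr rfl fun j _ => Finset.sum_congr rfl fun p _ =>
    Finset.sum_congr rfl fun k _ => ?_
  ring

theorem vfWord_eq_sum_oshTerm (hF : ContDiff ℝ (⊤ : ℕ∞) F) (N M : ℕ) (γ : List (Fin dV))
    (hN : γ.length ≤ N) (hM : γ.length ≤ M) {g : (Fin dW → ℝ) → ℝ}
    (hg : ContDiff ℝ (⊤ : ℕ∞) g) (y : Fin dW → ℝ) :
    vfWord F γ g y = ∑ m ∈ Finset.range (M + 1), oshTerm F N m γ g y := by
  induction M generalizing γ g with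
  | zero =>
    obtain rfl : γ = [] := List.length_eq_zero_iff.1 (by omega)
    simp [oshTerm_zero_nil, vfWord]
  | succ M ih =>
    rw [Finset.sum_range_succ']
    rcases List.eq_nil_or_concat' γ with rfl | ⟨γ, b, rfl⟩
    · simp [oshTerm_zero_nil, oshTerm_succ_nil, vfWord]
    · simp only [List.length_append, List.length_singleton] at hN hM
      rw [oshTerm_zero_of_ne_nil N (by simp), add_zero, vfWord_concat hF γ b hg]
      simp only [oshTerm_succ_concat N _ (show γ.length < N by omega) b hg, ← unshuffleSum_sum]
      refine unshuffleSum_congr γ fun u v hu _ => ?_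
      rw [Finset.sum_comm]
      refine Finset.sum_congr rfl fun k _ => ?_
      rw [← Finset.sum_mul,
        ih u (by omega) (by omega) (contDiff_fderiv_apply hg (Pi.single k 1))]

end VectorField

/-- For a smooth field of linear maps `F ∈ C^∞(W,L(V,W))`
and smooth `g`: (i) the iterated derivative reads right-to-left as well,
`F_{γ₁}⋯F_{γ_n} g = F_{γ₁}⋯F_{γ_{n−1}}(F_{γ_n} g)` for `n ≥ 2`; and (ii)
the ordered-shuffle expansion holds:
`F_γ g(y) = Σ ∂_{k₁…k_m}g(y) F_{γ¹}𝟙^{k₁}(y) ⋯ F_{γᵐ}𝟙^{k_m}(y)`, summed over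
decompositions of `γ` into ordered shuffles of nonempty words `γ¹,…,γᵐ`
(counted with multiplicity), `𝟙^k` being the k-th coordinate function. -/
theorem rde_vector_field_iteration (dW dV : ℕ)
    (F : (Fin dW → ℝ) → Fin dV → Fin dW → ℝ) (hF : ContDiff ℝ (⊤ : ℕ∞) F) :
    (∀ (g : (Fin dW → ℝ) → ℝ), ContDiff ℝ (⊤ : ℕ∞) g →
      ∀ (l : List (Fin dV)), l ≠ [] → ∀ (γ : Fin dV) (y : Fin dW → ℝ),
        vfWord F (l ++ [γ]) g y = vfWord F l (vf F γ g) y) ∧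
    (∀ (g : (Fin dW → ℝ) → ℝ), ContDiff ℝ (⊤ : ℕ∞) g →
      ∀ (γ : List (Fin dV)), γ ≠ [] → ∀ y : Fin dW → ℝ,
        vfWord F γ g y =
          ∑ m ∈ Finset.Icc 1 γ.length, ∑ parts : Fin m → BWord dV γ.length,
            ((oshMany (List.ofFn fun i => bwList (parts i))).count γ : ℝ) *
              ∑ k : Fin m → Fin dW,
                iteratedFDeriv ℝ m g y (fun i => Pi.single (k i) 1) *
                  ∏ i, vfWord F (bwList (parts i)) (fun z => z (k i)) y) := by
  refine ⟨fun g _ l _ γ y => by rw [vfWord_append]; rfl, fun g hg γ hγ y => ?_⟩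
  rw [vfWord_eq_sum_oshTerm hF γ.length γ.length γ le_rfl le_rfl hg, Finset.sum_range_succ',
    oshTerm_zero_of_ne_nil _ hγ, add_zero, Finset.range_eq_Ico,
    Finset.sum_Ico_add' (fun m => oshTerm F γ.length m γ g y), zero_add,
    Finset.Ico_add_one_right_eq_Icc]
  rfl
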